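/- arXiv:1310.5995 — 3 statements merged into one kernel-verified Lean document; each statement's English description precedes it below -/
import Mathlib

section
/- Let h = 2. There exist c_* ∈ (0.712, 0.713) such that z² − c_*z − 1 + 3e^{−2c_*z} = 0 has a double positive root, and c^* ∈ (0.751, 0.752) such that z² − c^*z − 1 − 0.25e^{−2c^*z} = 0 has a double negative root; and for every c ∈ [c_*, c^*], denoting by 0 < μ₂(c) ≤ μ₁(c) the positive real roots of z² − cz − 1 + 3e^{−2cz} = 0, one has 1/(1 + μ₁(c)μ₂(c)) > (1 + 1.53c²)/(2.55 + 1.53c²) > 0.53. -/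
open Real Filter Set Topology

noncomputable section

/-- Characteristic function `z² − cz − 1 + k·e^{−zch}` (real version). -/
def chi (k c h : ℝ) : ℝ → ℝ := fun z => z ^ 2 - c * z - 1 + k * Real.exp (-(z * c * h))

/-- Hypothesis (UM): `g : [0,∞) → [0,∞)` is continuous, has exactly one positive local
extremum point `θ` which is a global maximum point, has exactly two fixed points `0` and
`κ > 0`, is differentiable at `0` and at `κ` with `g'(0) = g₀ > 1` and `g'(κ) = gκ < 1`,
`g(x) > x` on `(0,κ)` and `g(x) < x` for `x > κ`. -/
structure UMHyp (g : ℝ → ℝ) (θ κ g₀ gκ : ℝ) : Prop where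
  cont : ContinuousOn g (Ici 0)
  nonneg : ∀ x ∈ Ici (0:ℝ), 0 ≤ g x
  theta_pos : 0 < θ
  kappa_pos : 0 < κ
  unique_ext : ∀ x : ℝ, 0 < x → ((IsLocalMax g x ∨ IsLocalMin g x) ↔ x = θ)
  global_max : ∀ x ∈ Ici (0:ℝ), g x ≤ g θ
  fixed_pts : ∀ x ∈ Ici (0:ℝ), (g x = x ↔ x = 0 ∨ x = κ)
  deriv0 : HasDerivWithinAt g g₀ (Ici 0) 0
  derivκ : HasDerivWithinAt g gκ (Ici 0) κ
  g0_gt_one : 1 < g₀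
  gκ_lt_one : gκ < 1
  above_id : ∀ x : ℝ, 0 < x → x < κ → x < g x
  below_id : ∀ x : ℝ, κ < x → g x < x

/-- A wavefront profile with speed `c` (and delay `h`): a positive `C²` solution of
`φ'' − cφ' − φ + g(φ(· − ch)) = 0` with `φ(−∞) = 0` and `φ(+∞) = κ`. -/
structure Wavefront (g : ℝ → ℝ) (κ c h : ℝ) (φ : ℝ → ℝ) : Prop where
  smooth : ContDiff ℝ 2 φ
  pos : ∀ t, 0 < φ t
  eqn : ∀ t, deriv (deriv φ) t - c * deriv φ t - φ t + g (φ (t - c * h)) = 0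
  lim_bot : Tendsto φ atBot (𝓝 0)
  lim_top : Tendsto φ atTop (𝓝 κ)

lemma hasDerivAt_chi (k c h z : ℝ) :
    HasDerivAt (chi k c h) (2 * z - c - c * h * (k * exp (-(z * c * h)))) z := by
  have hexp : HasDerivAt (fun z : ℝ => exp (-(z * c * h)))
      (exp (-(z * c * h)) * (-(1 * c * h))) z :=
    (((hasDerivAt_id z).mul_const c).mul_const h).neg.exp
  have := ((((hasDerivAt_id z).pow 2).sub ((hasDerivAt_id z).const_mul c)).sub_const 1).add
    (hexp.const_mul k)
  refine this.congr_deriv ?_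
  simp
  ring

lemma continuous_chi (k c h : ℝ) : Continuous (chi k c h) := by
  unfold chi
  fun_prop

/-- At a zero of `chi k c 2` the vanishing of the derivative is a quadratic condition that does
not involve `k`. -/
lemma deriv_chi_eq_zero_of_quadratic {k c z : ℝ} (h0 : chi k c 2 z = 0)
    (hq : 2 * c * z ^ 2 + 2 * (1 - c ^ 2) * z - 3 * c = 0) : deriv (chi k c 2) z = 0 := by
  rw [(hasDerivAt_chi k c 2 z).deriv]
  unfold chi at h0
  linear_combination hq - 2 * c * h0

/-- Truncation of the exponential series on `[-1, 1]` after the fifth-degree term. -/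
lemma abs_exp_sub_taylor_le {x : ℝ} (hx : |x| ≤ 1) :
    |exp x - (1 + x + x ^ 2 / 2 + x ^ 3 / 6 + x ^ 4 / 24 + x ^ 5 / 120)| ≤
      |x| ^ 6 * (7 / 4320) := by
  have h := Real.exp_bound hx (n := 6) (by norm_num)
  norm_num [Finset.sum_range_succ, Nat.factorial] at h ⊢
  exact h

lemma cosh_sinh_bounds {x : ℝ} (h0 : 0 ≤ x) (h1 : x ≤ 1) :
    |cosh x - (1 + x ^ 2 / 2 + x ^ 4 / 24)| ≤ x ^ 6 * (7 / 4320) ∧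
    |sinh x - (x + x ^ 3 / 6 + x ^ 5 / 120)| ≤ x ^ 6 * (7 / 4320) := by
  have hp := abs_exp_sub_taylor_le (x := x) (by rwa [abs_of_nonneg h0])
  have hm := abs_exp_sub_taylor_le (x := -x) (by rwa [abs_neg, abs_of_nonneg h0])
  rw [abs_neg] at hm
  rw [abs_of_nonneg h0, abs_le] at hp hm
  rw [cosh_eq, sinh_eq, abs_le, abs_le]
  refine ⟨⟨?_, ?_⟩, ?_, ?_⟩ <;> linarith [hp.1, hp.2, hm.1, hm.2]

lemma sinh_div_le {x : ℝ} (h0 : 0 < x) (h1 : x ≤ 0.86) :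
    sinh x / x ≤ 1 + x ^ 2 / 6 + (x ^ 2) ^ 2 / 100 := by
  have h := (abs_le.1 (cosh_sinh_bounds h0.le (by linarith)).2).2
  rw [div_le_iff₀ h0]
  have : x ^ 5 * x ≤ x ^ 5 * 0.86 := by gcongr
  have : 0 < x ^ 5 := by positivity
  nlinarith

lemma cosh_div_bounds {x : ℝ} (h0 : 0 < x) (h1 : x ≤ 0.86) :
    1 + x ^ 2 / 3 - (x ^ 2) ^ 2 / 40 ≤ cosh x / (sinh x / x) ∧
    cosh x / (sinh x / x) ≤ 1 + x ^ 2 / 3 := by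
  obtain ⟨hc, hs⟩ := cosh_sinh_bounds h0.le (by linarith)
  rw [abs_le] at hc hs
  have hS : 0 < sinh x / x := div_pos (sinh_pos_iff.2 h0) h0
  have hSu := sinh_div_le h0 h1
  have hX : x ^ 2 ≤ 0.75 := by nlinarith
  have hX0 : 0 < x ^ 2 := by positivity
  have hSl : 1 + x ^ 2 / 6 ≤ sinh x / x := by
    rw [le_div_iff₀ h0]
    have : x ^ 5 * x ≤ x ^ 5 * 0.86 := by gcongr
    have : 0 < x ^ 5 := by positivity
    nlinarith
  have e4 : x ^ 4 = (x ^ 2) ^ 2 := by ring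
  have e6 : x ^ 6 = (x ^ 2) ^ 3 := by ring
  rw [e4, e6] at hc
  generalize x ^ 2 = X at *
  have hX3 : X ^ 3 ≤ 0.75 * X ^ 2 := by nlinarith [sq_nonneg X]
  have hX2 : 0 < X ^ 2 := by positivity
  constructor
  · rw [le_div_iff₀ hS]
    have hpos : 0 ≤ 1 + X / 3 - X ^ 2 / 40 := by nlinarith
    nlinarith [mul_le_mul_of_nonneg_left hSu hpos, pow_pos hX0 3, pow_pos hX0 4]
  · rw [div_le_iff₀ hS]
    nlinarith [mul_le_mul_of_nonneg_left hSl (by positivity : 0 ≤ 1 + X / 3)]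

lemma exp_gt_of_pow_four {y b : ℝ} (hy : |y| ≤ 1) (hb : 0 ≤ b)
    (h : b < 1 + y + y ^ 2 / 2 + y ^ 3 / 6 + y ^ 4 / 24 + y ^ 5 / 120 - |y| ^ 6 * (7 / 4320)) :
    b ^ 4 < exp (4 * y) := by
  have := (abs_le.1 (abs_exp_sub_taylor_le hy)).1
  rw [show (4 : ℝ) * y = ((4 : ℕ) : ℝ) * y by norm_num, exp_nat_mul]
  exact pow_lt_pow_left₀ (by linarith) hb (by norm_num)

lemma exp_lt_of_pow_four {y b : ℝ} (hy : |y| ≤ 1)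
    (h : 1 + y + y ^ 2 / 2 + y ^ 3 / 6 + y ^ 4 / 24 + y ^ 5 / 120 + |y| ^ 6 * (7 / 4320) < b) :
    exp (4 * y) < b ^ 4 := by
  have := (abs_le.1 (abs_exp_sub_taylor_le hy)).2
  rw [show (4 : ℝ) * y = ((4 : ℕ) : ℝ) * y by norm_num, exp_nat_mul]
  exact pow_lt_pow_left₀ (by linarith) (exp_pos y).le (by norm_num)

/-- The left-hand side of the relation between the half-sum `m` of the roots and the square `D` of
their half-difference. -/
def rootRel (c m D T : ℝ) : ℝ := 2 * c * (m ^ 2 + D - c * m - 1) + (2 * m - c) * T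

lemma rootRel_mono {c m m' D D' T T' : ℝ} (hc : 0 < c) (hm : 0 < 2 * m - c) (hmm : m ≤ m')
    (hD : D ≤ D') (hT : T ≤ T') (hT' : 0 ≤ T') : rootRel c m D T ≤ rootRel c m' D' T' := by
  unfold rootRel
  have e1 : (2 * m - c) * T ≤ (2 * m' - c) * T' :=
    (mul_le_mul_of_nonneg_left hT hm.le).trans
      (mul_le_mul_of_nonneg_right (by linarith) hT')
  have e2 : m ^ 2 - c * m ≤ m' ^ 2 - c * m' := by nlinarith
  have e3 : 2 * c * (m ^ 2 + D - c * m - 1) ≤ 2 * c * (m' ^ 2 + D' - c * m' - 1) :=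
    mul_le_mul_of_nonneg_left (by linarith) (by positivity)
  linarith

lemma pow_succ_bounds {t : ℝ} (h0 : 0 ≤ t) (h1 : t ≤ 0.04) (n : ℕ) :
    0 ≤ t ^ (n + 1) ∧ t ^ (n + 1) ≤ 0.04 * t ^ n := by
  refine ⟨by positivity, ?_⟩
  rw [pow_succ, mul_comm]
  gcongr

lemma rootRel_neg {t : ℝ} (h0 : 0 ≤ t) (h1 : t ≤ 0.04) :
    rootRel (0.712 + t) (0.9281 + 0.236 * t) (1.335 * t - 0.003)
      (1 + 4 * (0.712 + t) ^ 2 * (1.335 * t - 0.003) / 3) < 0 := by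
  have p2 := pow_succ_bounds h0 h1 1
  have p3 := pow_succ_bounds h0 h1 2
  have p4 := pow_succ_bounds h0 h1 3
  norm_num at p2 p3 p4
  unfold rootRel
  ring_nf
  linarith [p2.1, p2.2, p3.1, p3.2, p4.1, p4.2]

lemma rootRel_pos {t : ℝ} (h0 : 0 ≤ t) (h1 : t ≤ 0.04) :
    0 < rootRel (0.712 + t) (0.92885 + 0.24 * t) (1.335 * t - 0.003)
      (1 + 4 * (0.712 + t) ^ 2 * (1.335 * t - 0.003) / 3 -
        (4 * (0.712 + t) ^ 2 * (1.335 * t - 0.003)) ^ 2 / 40) := by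
  have p2 := pow_succ_bounds h0 h1 1
  have p3 := pow_succ_bounds h0 h1 2
  have p4 := pow_succ_bounds h0 h1 3
  have p5 := pow_succ_bounds h0 h1 4
  have p6 := pow_succ_bounds h0 h1 5
  have p7 := pow_succ_bounds h0 h1 6
  have hsq : 0 ≤ t ^ 2 - 2 * 0.0187 * t + 0.0187 ^ 2 := by
    linear_combination sq_nonneg (t - 0.0187)
  norm_num at p2 p3 p4 p5 p6 p7 hsq
  unfold rootRel
  ring_nf
  linarith [p2.1, p2.2, p3.1, p3.2, p4.1, p4.2, p5.1, p5.2, p6.1, p6.2, p7.1, p7.2]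

lemma six_mul_lt {t : ℝ} (h0 : 0 ≤ t) (h1 : t ≤ 0.04) :
    6 * (0.712 + t) * (1 + 4 * (0.712 + t) ^ 2 * (1.335 * t - 0.003) / 6 +
        (4 * (0.712 + t) ^ 2 * (1.335 * t - 0.003)) ^ 2 / 100) <
      (2 * (0.9281 + 0.236 * t) - (0.712 + t)) *
        (3.743 * (1 + (2 * (0.712 + t) * (0.9281 + 0.236 * t) - 1.32) +
          (2 * (0.712 + t) * (0.9281 + 0.236 * t) - 1.32) ^ 2 / 2)) := by
  have p2 := pow_succ_bounds h0 h1 1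
  have p3 := pow_succ_bounds h0 h1 2
  have p4 := pow_succ_bounds h0 h1 3
  have p5 := pow_succ_bounds h0 h1 4
  have p6 := pow_succ_bounds h0 h1 5
  have p7 := pow_succ_bounds h0 h1 6
  norm_num at p2 p3 p4 p5 p6 p7
  ring_nf
  linarith [p2.1, p2.2, p3.1, p3.2, p4.1, p4.2, p5.1, p5.2, p6.1, p6.2, p7.1, p7.2]

lemma upper_product_lt {t : ℝ} (h0 : 0 ≤ t) (h1 : t ≤ 0.04) :
    ((0.92885 + 0.24 * t) ^ 2 - (1.335 * t - 0.003)) * (1 + 1.53 * (0.712 + t) ^ 2) < 1.55 := by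
  have p2 := pow_succ_bounds h0 h1 1
  have p3 := pow_succ_bounds h0 h1 2
  have p4 := pow_succ_bounds h0 h1 3
  norm_num at p2 p3 p4
  ring_nf
  linarith [p2.1, p2.2, p3.1, p3.2, p4.1, p4.2]

/-- A lower bound for `exp (2 * c * m)`, obtained by expanding the exponential at `1.32`. -/
lemma exp_lower {c m m₀ : ℝ} (hc : 0 < c) (hm : m₀ ≤ m) (hv : 1.32 ≤ 2 * c * m₀) :
    3.743 * (1 + (2 * c * m₀ - 1.32) + (2 * c * m₀ - 1.32) ^ 2 / 2) ≤ exp (2 * c * m) := by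
  have hb : (1.39093 : ℝ) ^ 4 < exp (4 * 0.33) :=
    exp_gt_of_pow_four (by norm_num [abs_le]) (by norm_num) (by norm_num [abs_of_pos])
  have hb' : 3.743 ≤ exp (4 * 0.33) := by
    refine le_trans ?_ hb.le
    norm_num
  have hle : 2 * c * m₀ ≤ 2 * c * m := by gcongr
  calc 3.743 * (1 + (2 * c * m₀ - 1.32) + (2 * c * m₀ - 1.32) ^ 2 / 2)
      ≤ exp (4 * 0.33) * exp (2 * c * m₀ - 1.32) :=
        mul_le_mul hb' (quadratic_le_exp_of_nonneg (by linarith))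
          (add_nonneg (by linarith) (by positivity)) (exp_pos _).le
    _ = exp (2 * c * m₀) := by rw [← exp_add]; congr 1; ring
    _ ≤ _ := exp_le_exp.2 hle

/-- The bound on `m ^ 2 - D`, the product of the numbers `m ± √D`, when these are the two roots.
In the intended use `T = x coth x` and `S = sinh x / x` with `x = 2 * c * √D`. -/
lemma sq_sub_mul_lt {c m D S T : ℝ} (hc : c ∈ Icc (0.712 : ℝ) 0.752) (hD : 0 ≤ D)
    (hX : 4 * c ^ 2 * D ≤ 0.75) (hS0 : 0 < S)
    (hS : S ≤ 1 + 4 * c ^ 2 * D / 6 + (4 * c ^ 2 * D) ^ 2 / 100)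
    (hTl : 1 + 4 * c ^ 2 * D / 3 - (4 * c ^ 2 * D) ^ 2 / 40 ≤ T)
    (hTu : T ≤ 1 + 4 * c ^ 2 * D / 3)
    (hA : rootRel c m D T = 0)
    (hB : 6 * c * S = (2 * m - c) * exp (2 * c * m)) :
    (m ^ 2 - D) * (1 + 1.53 * c ^ 2) < 1.55 := by
  obtain ⟨h1, h2⟩ := hc
  have hc0 : 0 < c := by linarith
  have hm : 0 < 2 * m - c := by
    have : 0 < (2 * m - c) * exp (2 * c * m) := by rw [← hB]; positivity
    exact pos_of_mul_pos_left this (exp_pos _).le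
  obtain ⟨t, rfl⟩ : ∃ t, c = 0.712 + t := ⟨c - 0.712, by ring⟩
  have ht0 : 0 ≤ t := by linarith
  have ht1 : t ≤ 0.04 := by linarith
  have hXn : 0 ≤ 4 * (0.712 + t) ^ 2 * D := by positivity
  have hneg := rootRel_neg ht0 ht1
  have hpos := rootRel_pos ht0 ht1
  have hsix := six_mul_lt ht0 ht1
  have hprod := upper_product_lt ht0 ht1
  have hv : 1.32 ≤ 2 * (0.712 + t) * (0.9281 + 0.236 * t) := by
    linear_combination 2.192264 * ht0 + 0.472 * sq_nonneg t
  have hXl : -0.01 ≤ 4 * (0.712 + t) ^ 2 * (1.335 * t - 0.003) := by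
    have : (0.712 + t) ^ 2 ≤ 0.752 ^ 2 := by gcongr
    linear_combination 0.012 * this + 5.34 * mul_nonneg (sq_nonneg (0.712 + t)) ht0
  rcases le_or_gt D (1.335 * t - 0.003) with hle | hgt
  · exfalso
    have hXle : 4 * (0.712 + t) ^ 2 * D ≤ 4 * (0.712 + t) ^ 2 * (1.335 * t - 0.003) := by gcongr
    generalize 1.335 * t - 0.003 = D₀ at *
    generalize hm₀ : 0.9281 + 0.236 * t = m₀ at *
    have hmm : m₀ ≤ m := by
      by_contra! hlt
      have := rootRel_mono (T := T) (T' := 1 + 4 * (0.712 + t) ^ 2 * D₀ / 3) hc0 hm hlt.le hle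
        (by linarith) (by linarith)
      linarith
    have hexp := exp_lower hc0 hmm hv
    have hSle : S ≤ 1 + 4 * (0.712 + t) ^ 2 * D₀ / 6 + (4 * (0.712 + t) ^ 2 * D₀) ^ 2 / 100 := by
      refine hS.trans ?_
      gcongr
    have e1 := mul_le_mul (by linarith : 2 * m₀ - (0.712 + t) ≤ 2 * m - (0.712 + t)) hexp
      (mul_nonneg (by norm_num) (add_nonneg (by linarith) (by positivity))) hm.le
    have e2 : 6 * (0.712 + t) * S ≤ 6 * (0.712 + t) *
      (1 + 4 * (0.712 + t) ^ 2 * D₀ / 6 + (4 * (0.712 + t) ^ 2 * D₀) ^ 2 / 100) := by gcongr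
    linarith
  · have hXle : 4 * (0.712 + t) ^ 2 * (1.335 * t - 0.003) ≤ 4 * (0.712 + t) ^ 2 * D := by gcongr
    generalize 1.335 * t - 0.003 = D₀ at *
    generalize hm₁ : 0.92885 + 0.24 * t = m₁ at *
    have hmm : m < m₁ := by
      by_contra! hlt
      have hT : 1 + 4 * (0.712 + t) ^ 2 * D₀ / 3 - (4 * (0.712 + t) ^ 2 * D₀) ^ 2 / 40 ≤ T := by
        refine le_trans ?_ hTl
        clear * - hXle hXl hX hXn
        generalize 4 * (0.712 + t) ^ 2 * D₀ = X₀ at *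
        generalize 4 * (0.712 + t) ^ 2 * D = X at *
        nlinarith
      have hT0 : 0 ≤ T := by
        refine le_trans ?_ hTl
        clear * - hX hXn
        generalize 4 * (0.712 + t) ^ 2 * D = X at *
        nlinarith
      have := rootRel_mono hc0 (by linarith) hlt hgt.le hT hT0
      linarith
    have e1 : m ^ 2 ≤ m₁ ^ 2 := pow_le_pow_left₀ (by linarith) hmm.le 2
    refine lt_of_le_of_lt ?_ hprod
    gcongr

lemma lt_of_chi_eq_zero {c z : ℝ} (hc : c ∈ Icc (0.712 : ℝ) 0.752) (hz : 0 < z)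
    (h : chi 3 c 2 z = 0) : 0.35 < z ∧ z < 1.45 := by
  obtain ⟨h1, h2⟩ := hc
  unfold chi at h
  constructor
  · have := add_one_le_exp (-(z * c * 2))
    by_contra! hle
    nlinarith [mul_le_mul hle h2 (by linarith) (by norm_num)]
  · have := exp_pos (-(z * c * 2))
    by_contra! hle
    nlinarith [mul_le_mul_of_nonneg_right h2 hz.le]

lemma mul_bound_of_ne {c μ₂ μ₁ : ℝ} (hc : c ∈ Icc (0.712 : ℝ) 0.752) (h2 : 0 < μ₂)
    (hlt : μ₂ < μ₁) (hf2 : chi 3 c 2 μ₂ = 0) (hf1 : chi 3 c 2 μ₁ = 0) :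
    μ₁ * μ₂ * (1 + 1.53 * c ^ 2) < 1.55 := by
  have hb2 := (lt_of_chi_eq_zero hc h2 hf2).1
  have hb1 := (lt_of_chi_eq_zero hc (h2.trans hlt) hf1).2
  have hc0 : 0 < c := by linarith [hc.1]
  obtain ⟨m, d, rfl, rfl⟩ : ∃ m d, μ₂ = m - d ∧ μ₁ = m + d :=
    ⟨(μ₁ + μ₂) / 2, (μ₁ - μ₂) / 2, by ring, by ring⟩
  have hd : 0 < d := by linarith
  set x := 2 * c * d with hx
  have hx0 : 0 < x := by positivity
  have hx1 : x ≤ 0.86 := by nlinarith [hc.2]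
  have hX : x ^ 2 = 4 * c ^ 2 * d ^ 2 := by rw [hx]; ring
  have hS := sinh_div_le hx0 hx1
  obtain ⟨hTl, hTu⟩ := cosh_div_bounds hx0 hx1
  have hS0 : 0 < sinh x / x := div_pos (sinh_pos_iff.2 hx0) hx0
  unfold chi at hf1 hf2
  rw [show -((m - d) * c * 2) = -(2 * c * m) + x by rw [hx]; ring, exp_add] at hf2
  rw [show -((m + d) * c * 2) = -(2 * c * m) + -x by rw [hx]; ring, exp_add] at hf1
  have hB : 6 * c * (sinh x / x) * exp (-(2 * c * m)) = 2 * m - c := by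
    have hmul : 3 * exp (-(2 * c * m)) * sinh x = (2 * m - c) * d := by
      rw [sinh_eq]
      linear_combination (hf2 - hf1) / 2
    have hcancel : 6 * c * (sinh x / x) * d = 3 * sinh x := by
      rw [hx]
      field_simp
      ring
    apply mul_right_cancel₀ hd.ne'
    linear_combination exp (-(2 * c * m)) * hcancel + hmul
  have hA : m ^ 2 + d ^ 2 - c * m - 1 + 3 * exp (-(2 * c * m)) * cosh x = 0 := by
    rw [cosh_eq]
    linear_combination (hf1 + hf2) / 2
  have hC : sinh x / x * (cosh x / (sinh x / x)) = cosh x := mul_div_cancel₀ _ hS0.ne'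
  have key := sq_sub_mul_lt (m := m) (T := cosh x / (sinh x / x)) hc (sq_nonneg d)
    (by rw [← hX]; nlinarith) hS0
    (by rwa [← hX]) (by rwa [← hX]) (by rwa [← hX])
    (by
      unfold rootRel
      rw [← hB]
      linear_combination 2 * c * hA + 6 * c * exp (-(2 * c * m)) * hC)
    (by
      rw [← hB, mul_assoc _ (exp _), ← exp_add]
      simp)
  linear_combination key

lemma mul_self_bound {c μ : ℝ} (hc : c ∈ Icc (0.712 : ℝ) 0.752) (hμ : 0 < μ)
    (hf : chi 3 c 2 μ = 0) (huniq : ∀ x : ℝ, 0 < x → chi 3 c 2 x = 0 → x = μ) :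
    μ * μ * (1 + 1.53 * c ^ 2) < 1.55 := by
  have hc0 : 0 < c := by linarith [hc.1]
  have hnonneg : ∀ y, 0 < y → 0 ≤ chi 3 c 2 y := by
    intro y hy
    by_contra! hneg
    have hzero : 0 < chi 3 c 2 0 := by norm_num [chi]
    have hlarge : 0 < chi 3 c 2 (y + 2) := by
      have := exp_pos (-((y + 2) * c * 2))
      unfold chi
      nlinarith [hc.2]
    obtain ⟨a, ha, ha0⟩ := intermediate_value_Ioo' hy.le (continuous_chi 3 c 2).continuousOn
      ⟨hneg, hzero⟩
    obtain ⟨b, hb, hb0⟩ := intermediate_value_Ioo (by linarith : y ≤ y + 2)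
      (continuous_chi 3 c 2).continuousOn ⟨hneg, hlarge⟩
    have := huniq a ha.1 ha0
    have := huniq b (hy.trans hb.1) hb0
    linarith [ha.2, hb.1]
  have hmin : IsLocalMin (chi 3 c 2) μ := by
    filter_upwards [lt_mem_nhds hμ] with y hy
    rw [hf]
    exact hnonneg y hy
  have hd := hmin.hasDerivAt_eq_zero (hasDerivAt_chi 3 c 2 μ)
  unfold chi at hf
  rw [show -(μ * c * 2) = -(2 * c * μ) by ring] at hf hd
  have key := sq_sub_mul_lt (c := c) (m := μ) (D := 0) (S := 1) (T := 1) hc le_rfl (by norm_num)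
    one_pos (by norm_num) (by norm_num) (by norm_num) (by unfold rootRel; linear_combination 2 * c * hf + hd)
    (by
      rw [show 2 * μ - c = 6 * c * exp (-(2 * c * μ)) by linear_combination hd,
        mul_assoc _ (exp _), ← exp_add]
      simp)
  linear_combination key

/-- The roots `z` of `2 * c * z ^ 2 + 2 * (1 - c ^ 2) * z - 3 * c` are given by the two signs `s`. -/
def critRoot (s c : ℝ) : ℝ := (c ^ 2 - 1 + s * √((1 - c ^ 2) ^ 2 + 6 * c ^ 2)) / (2 * c)

lemma critRoot_quadratic {s c : ℝ} (hs : s ^ 2 = 1) (hc : 0 < c) :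
    2 * c * critRoot s c ^ 2 + 2 * (1 - c ^ 2) * critRoot s c - 3 * c = 0 := by
  have h := sq_sqrt (by positivity : 0 ≤ (1 - c ^ 2) ^ 2 + 6 * c ^ 2)
  unfold critRoot
  generalize √((1 - c ^ 2) ^ 2 + 6 * c ^ 2) = r at h
  field_simp
  linear_combination s ^ 2 * h + ((1 - c ^ 2) ^ 2 + 6 * c ^ 2) * hs

lemma critRoot_bounds {s c a b l u : ℝ} (hc : 0 < c) (hb : 0 ≤ b)
    (hal : a ^ 2 ≤ (1 - c ^ 2) ^ 2 + 6 * c ^ 2) (hbu : (1 - c ^ 2) ^ 2 + 6 * c ^ 2 ≤ b ^ 2)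
    (hl1 : l * (2 * c) ≤ c ^ 2 - 1 + s * a) (hl2 : l * (2 * c) ≤ c ^ 2 - 1 + s * b)
    (hu1 : c ^ 2 - 1 + s * a ≤ u * (2 * c)) (hu2 : c ^ 2 - 1 + s * b ≤ u * (2 * c)) :
    l ≤ critRoot s c ∧ critRoot s c ≤ u := by
  have h1 : a ≤ √((1 - c ^ 2) ^ 2 + 6 * c ^ 2) := le_sqrt_of_sq_le hal
  have h2 : √((1 - c ^ 2) ^ 2 + 6 * c ^ 2) ≤ b := (sqrt_le_left hb).2 hbu
  unfold critRoot
  rw [le_div_iff₀ (by positivity), div_le_iff₀ (by positivity)]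
  rcases le_total 0 s with hs | hs
  · constructor <;> nlinarith
  · constructor <;> nlinarith

lemma continuousOn_chi_critRoot (k s : ℝ) {a b : ℝ} (ha : 0 < a) :
    ContinuousOn (fun c => chi k c 2 (critRoot s c)) (Icc a b) := by
  have hr : ContinuousOn (critRoot s) (Icc a b) := by
    unfold critRoot
    refine ContinuousOn.div (by fun_prop) (by fun_prop) ?_
    intro c hc
    have : 0 < c := ha.trans_le hc.1
    positivity
  unfold chi
  fun_prop

lemma exists_double_root {k s a b : ℝ} (hs : s ^ 2 = 1) (ha : 0 < a) (hab : a ≤ b)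
    (h1 : 0 < chi k a 2 (critRoot s a)) (h2 : chi k b 2 (critRoot s b) < 0) :
    ∃ c ∈ Ioo a b, chi k c 2 (critRoot s c) = 0 ∧ deriv (chi k c 2) (critRoot s c) = 0 := by
  obtain ⟨c, hc, h0⟩ := intermediate_value_Ioo' hab (continuousOn_chi_critRoot k s ha) ⟨h2, h1⟩
  exact ⟨c, hc, h0, deriv_chi_eq_zero_of_quadratic h0 (critRoot_quadratic hs (ha.trans hc.1))⟩

lemma chi_three_critRoot_pos : 0 < chi 3 0.712 2 (critRoot 1 0.712) := by
  obtain ⟨hl, hu⟩ := critRoot_bounds (s := 1) (c := 0.712) (a := 1.812392) (b := 1.812393)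
    (l := 0.9265) (u := 0.92651) (by norm_num) (by norm_num) (by norm_num) (by norm_num)
    (by norm_num) (by norm_num) (by norm_num) (by norm_num)
  generalize critRoot 1 0.712 = z at hl hu
  have hb : (0.719035 : ℝ) ^ 4 < exp (4 * (-(0.92651 * 0.356))) :=
    exp_gt_of_pow_four (by norm_num [abs_le]) (by norm_num) (by norm_num)
  have hexp : exp (4 * (-(0.92651 * 0.356))) ≤ exp (-(z * 0.712 * 2)) :=
    exp_le_exp.2 (by linarith)
  unfold chi
  norm_num at hb
  nlinarith

lemma chi_three_critRoot_neg : chi 3 0.713 2 (critRoot 1 0.713) < 0 := by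
  obtain ⟨hl, hu⟩ := critRoot_bounds (s := 1) (c := 0.713) (a := 1.814363) (b := 1.814364)
    (l := 0.92758) (u := 0.92759) (by norm_num) (by norm_num) (by norm_num) (by norm_num)
    (by norm_num) (by norm_num) (by norm_num) (by norm_num)
  generalize critRoot 1 0.713 = z at hl hu
  have hb : exp (4 * (-(0.92758 * 0.3565))) < (0.718436 : ℝ) ^ 4 :=
    exp_lt_of_pow_four (by norm_num [abs_le]) (by norm_num)
  have hexp : exp (-(z * 0.713 * 2)) ≤ exp (4 * (-(0.92758 * 0.3565))) :=
    exp_le_exp.2 (by linarith)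
  unfold chi
  norm_num at hb
  nlinarith

lemma chi_neg_quarter_critRoot_pos : 0 < chi (-0.25) 0.751 2 (critRoot (-1) 0.751) := by
  obtain ⟨hl, hu⟩ := critRoot_bounds (s := -1) (c := 0.751) (a := 1.890529) (b := 1.890530)
    (l := -1.54896) (u := -1.54895) (by norm_num) (by norm_num) (by norm_num) (by norm_num)
    (by norm_num) (by norm_num) (by norm_num) (by norm_num)
  generalize critRoot (-1) 0.751 = z at hl hu
  have hb : exp (4 * (1.54896 * 0.3755)) < (1.788966 : ℝ) ^ 4 :=
    exp_lt_of_pow_four (by norm_num [abs_le]) (by norm_num)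
  have hexp : exp (-(z * 0.751 * 2)) ≤ exp (4 * (1.54896 * 0.3755)) :=
    exp_le_exp.2 (by linarith)
  unfold chi
  norm_num at hb
  nlinarith

lemma chi_neg_quarter_critRoot_neg : chi (-0.25) 0.752 2 (critRoot (-1) 0.752) < 0 := by
  obtain ⟨hl, hu⟩ := critRoot_bounds (s := -1) (c := 0.752) (a := 1.892567) (b := 1.892568)
    (l := -1.54725) (u := -1.54724) (by norm_num) (by norm_num) (by norm_num) (by norm_num)
    (by norm_num) (by norm_num) (by norm_num) (by norm_num)
  generalize critRoot (-1) 0.752 = z at hl hu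
  have hb : (1.789065 : ℝ) ^ 4 < exp (4 * (1.54724 * 0.376)) :=
    exp_gt_of_pow_four (by norm_num [abs_le]) (by norm_num) (by norm_num)
  have hexp : exp (4 * (1.54724 * 0.376)) ≤ exp (-(z * 0.752 * 2)) :=
    exp_le_exp.2 (by linarith)
  unfold chi
  norm_num at hb
  nlinarith

lemma critRoot_one_pos {c : ℝ} (h0 : 0 < c) : 0 < critRoot 1 c := by
  unfold critRoot
  have : 1 - c ^ 2 < √((1 - c ^ 2) ^ 2 + 6 * c ^ 2) :=
    (le_abs_self _).trans_lt (by
      rw [← sqrt_sq_eq_abs]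
      exact sqrt_lt_sqrt (sq_nonneg _) (by linarith [pow_pos h0 2]))
  exact div_pos (by linarith) (by positivity)

lemma critRoot_neg_one_neg {c : ℝ} (h0 : 0 < c) : critRoot (-1) c < 0 := by
  unfold critRoot
  have : c ^ 2 - 1 < √((1 - c ^ 2) ^ 2 + 6 * c ^ 2) :=
    (le_abs_self _).trans_lt (by
      rw [← sqrt_sq_eq_abs]
      exact sqrt_lt_sqrt (sq_nonneg _) (by linarith [pow_pos h0 2]))
  exact div_neg_of_neg_of_pos (by linarith) (by positivity)

/-- for `h = 2` there are `c_* ∈ (0.712, 0.713)` (double positive root of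
`z² − cz − 1 + 3e^{−2cz}`) and `c^* ∈ (0.751, 0.752)` (double negative root of
`z² − cz − 1 − 0.25e^{−2cz}`) such that for every `c ∈ [c_*, c^*]`, if `0 < μ₂ ≤ μ₁` are
the positive real roots of `z² − cz − 1 + 3e^{−2cz} = 0`, then
`1/(1 + μ₁μ₂) > (1 + 1.53c²)/(2.55 + 1.53c²) > 0.53`. -/
theorem stmt15 :
    ∃ cstar ∈ Ioo (0.712 : ℝ) 0.713, ∃ cup ∈ Ioo (0.751 : ℝ) 0.752,
      (∃ z : ℝ, 0 < z ∧ chi 3 cstar 2 z = 0 ∧ deriv (chi 3 cstar 2) z = 0) ∧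
      (∃ w : ℝ, w < 0 ∧ chi (-0.25) cup 2 w = 0 ∧ deriv (chi (-0.25) cup 2) w = 0) ∧
      ∀ c ∈ Icc cstar cup, ∀ μ₂ μ₁ : ℝ,
        0 < μ₂ → μ₂ ≤ μ₁ → chi 3 c 2 μ₂ = 0 → chi 3 c 2 μ₁ = 0 →
        (∀ x : ℝ, 0 < x → chi 3 c 2 x = 0 → x = μ₂ ∨ x = μ₁) →
        (1 + 1.53 * c ^ 2) / (2.55 + 1.53 * c ^ 2) < 1 / (1 + μ₁ * μ₂) ∧
        (0.53 : ℝ) < (1 + 1.53 * c ^ 2) / (2.55 + 1.53 * c ^ 2) := by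
  obtain ⟨c₁, hc₁, h₁, h₁'⟩ := exists_double_root (s := 1) (by norm_num) (by norm_num)
    (by norm_num) chi_three_critRoot_pos chi_three_critRoot_neg
  obtain ⟨c₂, hc₂, h₂, h₂'⟩ := exists_double_root (s := -1) (by norm_num) (by norm_num)
    (by norm_num) chi_neg_quarter_critRoot_pos chi_neg_quarter_critRoot_neg
  refine ⟨c₁, hc₁, c₂, hc₂, ⟨_, critRoot_one_pos (by linarith [hc₁.1]), h₁, h₁'⟩,
    ⟨_, critRoot_neg_one_neg (by linarith [hc₂.1]), h₂, h₂'⟩, ?_⟩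
  intro c hc μ₂ μ₁ hpos hle hf₂ hf₁ huniq
  have hcI : c ∈ Icc (0.712 : ℝ) 0.752 := ⟨hc₁.1.le.trans hc.1, hc.2.trans hc₂.2.le⟩
  have key : μ₁ * μ₂ * (1 + 1.53 * c ^ 2) < 1.55 := by
    rcases hle.eq_or_lt with rfl | hlt
    · exact mul_self_bound hcI hpos hf₂ fun x hx h0 => (or_self_iff.1 (huniq x hx h0))
    · exact mul_bound_of_ne hcI hpos hlt hf₂ hf₁
  have hμ : 0 < μ₁ * μ₂ := mul_pos (hpos.trans_le hle) hpos
  constructor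
  · rw [div_lt_div_iff₀ (by positivity) (by positivity)]
    linarith
  · rw [lt_div_iff₀ (by positivity)]
    nlinarith [hcI.1]

end
end

section
/- For every u ∈ [−0.135, 0), one has 1 − 2.04u + 1.9u² > e^{−2u}; and for every u ∈ (0, 0.228], one has 1 − 2.04u + 1.9u² < e^{−2u}. -/
open Real Set

/-- The degree five Taylor polynomial of `exp` at `0`, with a sixth order error bound. -/
lemma abs_exp_sub_taylor_five_le {x : ℝ} (hx : |x| ≤ 1) :
    |Real.exp x - (1 + x + x ^ 2 / 2 + x ^ 3 / 6 + x ^ 4 / 24 + x ^ 5 / 120)| ≤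
      x ^ 6 * (7 / 4320) := by
  have h := Real.exp_bound hx (n := 6) (by norm_num)
  norm_num [Finset.sum_range_succ, Nat.factorial, Even.pow_abs (show Even 6 by decide)] at h
  exact h

lemma exp_lt_quadratic {x : ℝ} (h0 : 0 < x) (h1 : x ≤ 0.27) :
    Real.exp x < 1 + 1.02 * x + 0.475 * x ^ 2 := by
  have h := (abs_le.mp (abs_exp_sub_taylor_five_le (x := x)
    (abs_le.mpr ⟨by linarith, by linarith⟩))).2
  have h2 : x ^ 2 ≤ 0.27 ^ 2 := by gcongr
  have h3 : x ^ 3 ≤ 0.27 ^ 3 := by gcongr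
  have h4 : x ^ 4 ≤ 0.27 ^ 4 := by gcongr
  have h5 : x ^ 5 ≤ 0.27 ^ 5 := by gcongr
  have key : 0 < x * (0.02 - 0.025 * x - x ^ 2 / 6 - x ^ 3 / 24 - x ^ 4 / 120
      - x ^ 5 * (7 / 4320)) := by
    apply mul_pos h0
    norm_num at *
    linarith
  linarith

lemma quadratic_lt_exp_neg {y : ℝ} (h0 : 0 < y) (h1 : y ≤ 0.456) :
    1 - 1.02 * y + 0.475 * y ^ 2 < Real.exp (-y) := by
  have h := (abs_le.mp (abs_exp_sub_taylor_five_le (x := -y)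
    (abs_le.mpr ⟨by linarith, by linarith⟩))).1
  have h2 : y / 6 - y ^ 2 / 24 ≤ 0.456 / 6 - 0.456 ^ 2 / 24 := by nlinarith
  have h3 : y ^ 3 ≤ 0.456 ^ 3 := by gcongr
  have h4 : y ^ 4 ≤ 0.456 ^ 4 := by gcongr
  have hM : y / 6 - y ^ 2 / 24 + y ^ 3 / 120 + y ^ 4 * (7 / 4320) ≤ 0.0685 := by
    norm_num at *
    linarith
  have key : 0 < y * (0.02 + 0.025 * y
      - y * (y / 6 - y ^ 2 / 24 + y ^ 3 / 120 + y ^ 4 * (7 / 4320))) := by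
    apply mul_pos h0
    have := mul_le_mul_of_nonneg_left hM h0.le
    norm_num at *
    linarith
  linarith

/-- `1 − 2.04u + 1.9u² > e^{−2u}` for `u ∈ [−0.135, 0)` and
`1 − 2.04u + 1.9u² < e^{−2u}` for `u ∈ (0, 0.228]`. -/
theorem stmt16 :
    (∀ u ∈ Ico (-0.135 : ℝ) 0, Real.exp (-(2 * u)) < 1 - 2.04 * u + 1.9 * u ^ 2) ∧
    (∀ u ∈ Ioc (0 : ℝ) 0.228, 1 - 2.04 * u + 1.9 * u ^ 2 < Real.exp (-(2 * u))) := by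
  refine ⟨fun u hu => ?_, fun u hu => ?_⟩
  · have h := exp_lt_quadratic (x := -(2 * u)) (by linarith [hu.2]) (by linarith [hu.1])
    linarith
  · have h := quadratic_lt_exp_neg (y := 2 * u) (by linarith [hu.1]) (by linarith [hu.2])
    linarith
end

section
/- Let g satisfy hypothesis (UM), let c > 0, h ≥ 0, and let φ : ℝ → (0,∞) be a bounded twice continuously differentiable solution of φ''(t) − cφ'(t) − φ(t) + g(φ(t − ch)) = 0 on ℝ with 0 < φ(t) ≤ g(θ) for all t. Let z₁ < 0 < z₂ be the real roots of z² − cz − 1 = 0 (so z₂ − z₁ = √(c² + 4)). Then for every t ∈ ℝ, φ(t) = (1/(z₂ − z₁)) ( ∫_{−∞}^{t} e^{z₁(t−s)} g(φ(s − ch)) ds + ∫_{t}^{+∞} e^{z₂(t−s)} g(φ(s − ch)) ds ), and consequently |φ'(t)| ≤ g(θ)/√(c² + 4) for all t ∈ ℝ. -/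
open Real Filter Set Topology

noncomputable section

open MeasureTheory

/-- The function `s ↦ e^{z(t-s)}` is integrable on `(t, ∞)` for `z > 0`. -/
theorem integrableOn_exp_mul_const_sub_Ioi {z : ℝ} (hz : 0 < z) (t : ℝ) :
    IntegrableOn (fun s : ℝ => Real.exp (z * (t - s))) (Ioi t) := by
  have hcongr : ∀ s, Real.exp (z * t) * Real.exp (-z * s) = Real.exp (z * (t - s)) := by
    intro s
    rw [← Real.exp_add]
    ring_nf
  simpa only [IntegrableOn, hcongr] using
    (integrableOn_exp_mul_Ioi (neg_lt_zero.mpr hz) t).const_mul (Real.exp (z * t))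

/-- A solution of `v' = z v - f` with `z > 0` and `f` continuous and bounded, which stays bounded
along a sequence tending to `+∞`, is given by the variation of constants formula from `+∞`. -/
theorem eq_integral_Ici_of_hasDerivAt {z M C : ℝ} (hz : 0 < z) {f v : ℝ → ℝ} {σ : ℕ → ℝ}
    (hf : Continuous f) (hfM : ∀ s, |f s| ≤ M)
    (hv : ∀ s, HasDerivAt v (z * v s - f s) s)
    (hσ : Tendsto σ atTop atTop) (hvσ : ∀ n, |v (σ n)| ≤ C) (t : ℝ) :
    v t = ∫ s in Ici t, Real.exp (z * (t - s)) * f s := by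
  rw [integral_Ici_eq_integral_Ioi]
  have hcont : Continuous fun s : ℝ => Real.exp (z * (t - s)) * f s := by fun_prop
  have hint : IntegrableOn (fun s : ℝ => Real.exp (z * (t - s)) * f s) (Ioi t) :=
    Integrable.mul_bdd (c := M) (integrableOn_exp_mul_const_sub_Ioi hz t) hf.aestronglyMeasurable (Eventually.of_forall hfM)
  have hderiv : ∀ s, HasDerivAt (fun s => -(Real.exp (z * (t - s)) * v s))
      (Real.exp (z * (t - s)) * f s) s := by
    intro s
    have h₁ : HasDerivAt (fun s => z * (t - s)) (-z) s := by
      simpa using ((hasDerivAt_id s).const_sub t).const_mul z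
    exact (h₁.exp.mul (hv s)).neg.congr_deriv (by ring)
  have hftc : ∀ n, ∫ s in t..σ n, Real.exp (z * (t - s)) * f s =
      v t - Real.exp (z * (t - σ n)) * v (σ n) := by
    intro n
    rw [intervalIntegral.integral_eq_sub_of_hasDerivAt (fun s _ => hderiv s)
      (hcont.intervalIntegrable _ _)]
    simp
    ring
  have hexp_lim : Tendsto (fun n => Real.exp (z * (t - σ n))) atTop (𝓝 0) := by
    refine Real.tendsto_exp_atBot.comp (Tendsto.const_mul_atBot hz ?_)
    exact tendsto_atBot_add_const_left _ t (tendsto_neg_atTop_atBot.comp hσ)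
  have hzero : Tendsto (fun n => Real.exp (z * (t - σ n)) * v (σ n)) atTop (𝓝 0) := by
    refine squeeze_zero_norm (fun n => ?_) (by simpa using hexp_lim.mul_const C)
    rw [Real.norm_eq_abs, abs_mul, Real.abs_exp]
    exact mul_le_mul_of_nonneg_left (hvσ n) (Real.exp_pos _).le
  have hlim := intervalIntegral_tendsto_integral_Ioi t hint hσ
  simp only [hftc] at hlim
  exact tendsto_nhds_unique (by simpa using hzero.const_sub (v t)) hlim

/-- The exponential average `∫ₜ^∞ e^{z(t-s)} f(s) ds` of a function with values in `[0, M]` lies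
in `[0, M / z]`. -/
theorem integral_Ici_exp_mul_mem_Icc {z M : ℝ} (hz : 0 < z) {f : ℝ → ℝ}
    (hf₀ : ∀ s, 0 ≤ f s) (hfM : ∀ s, f s ≤ M) (t : ℝ) :
    z * ∫ s in Ici t, Real.exp (z * (t - s)) * f s ∈ Icc 0 M := by
  have hcongr : ∀ s, Real.exp (z * t) * Real.exp (-z * s) = Real.exp (z * (t - s)) := by
    intro s
    rw [← Real.exp_add]
    ring_nf
  have hval : ∫ s in Ioi t, Real.exp (z * (t - s)) = 1 / z := by
    simp only [← hcongr]
    rw [integral_const_mul, integral_exp_mul_Ioi (neg_lt_zero.mpr hz), mul_div_assoc',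
      mul_neg, hcongr, neg_div_neg_eq]
    simp
  rw [integral_Ici_eq_integral_Ioi]
  refine ⟨mul_nonneg hz.le (integral_nonneg fun s => mul_nonneg (Real.exp_pos _).le (hf₀ s)), ?_⟩
  calc z * ∫ s in Ioi t, Real.exp (z * (t - s)) * f s
      ≤ z * ∫ s in Ioi t, Real.exp (z * (t - s)) * M := by
        refine mul_le_mul_of_nonneg_left (integral_mono_of_nonneg ?_
          ((integrableOn_exp_mul_const_sub_Ioi hz t).mul_const M) ?_) hz.le
        · exact Eventually.of_forall fun s => mul_nonneg (Real.exp_pos _).le (hf₀ s)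
        · exact Eventually.of_forall fun s =>
            mul_le_mul_of_nonneg_left (hfM s) (Real.exp_pos _).le
    _ = M := by
        rw [integral_mul_const, hval]
        field_simp

/-- A differentiable function with values in `[0, M]` has a derivative bounded by `M` somewhere
in every interval of length one. -/
theorem exists_abs_deriv_le_of_mem_Icc {φ : ℝ → ℝ} {M : ℝ} (hφ : Differentiable ℝ φ)
    (h₀ : ∀ t, 0 ≤ φ t) (hM : ∀ t, φ t ≤ M) (a : ℝ) :
    ∃ s ∈ Ioo a (a + 1), |deriv φ s| ≤ M := by
  obtain ⟨s, hs, hd⟩ := exists_deriv_eq_slope φ (lt_add_one a) hφ.continuous.continuousOn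
    hφ.differentiableOn
  refine ⟨s, hs, ?_⟩
  rw [hd, add_sub_cancel_left, div_one, abs_le]
  constructor <;> linarith [h₀ a, h₀ (a + 1), hM a, hM (a + 1)]

/-- the integral representation of a bounded positive solution of the
profile equation, and the resulting bound `|φ'(t)| ≤ g(θ)/√(c² + 4)`. -/
theorem stmt17 (g : ℝ → ℝ) (θ κ g₀ gκ c h z₁ z₂ : ℝ)
    (hUM : UMHyp g θ κ g₀ gκ) (hc : 0 < c) (hh : 0 ≤ h)
    (hz₁ : z₁ < 0) (hz₂ : 0 < z₂)
    (hz₁eq : z₁ ^ 2 - c * z₁ - 1 = 0) (hz₂eq : z₂ ^ 2 - c * z₂ - 1 = 0)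
    (φ : ℝ → ℝ) (hsm : ContDiff ℝ 2 φ)
    (hpos : ∀ t, 0 < φ t) (hbd : ∀ t, φ t ≤ g θ)
    (heq : ∀ t, deriv (deriv φ) t - c * deriv φ t - φ t + g (φ (t - c * h)) = 0) :
    (∀ t : ℝ, φ t = (1 / (z₂ - z₁)) *
      ((∫ s in Iic t, Real.exp (z₁ * (t - s)) * g (φ (s - c * h))) +
        (∫ s in Ici t, Real.exp (z₂ * (t - s)) * g (φ (s - c * h))))) ∧
    (∀ t : ℝ, |deriv φ t| ≤ g θ / Real.sqrt (c ^ 2 + 4)) := by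
  have hlt : z₁ < z₂ := hz₁.trans hz₂
  have hsum : z₁ + z₂ = c := by
    have h : (z₂ - z₁) * (z₁ + z₂ - c) = 0 := by linear_combination hz₂eq - hz₁eq
    rcases mul_eq_zero.mp h with h | h <;> linarith
  have hprod : z₁ * z₂ = -1 := by
    rw [← hsum] at hz₁eq
    linear_combination -hz₁eq
  have hdiff : Differentiable ℝ φ := hsm.differentiable (by norm_num)
  have hdiff' : Differentiable ℝ (deriv φ) := by
    have h : ContDiff ℝ (1 + 1) φ := by simpa [one_add_one_eq_two] using hsm
    exact (contDiff_succ_iff_deriv.mp h).2.2.differentiable (by norm_num)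
  set f : ℝ → ℝ := fun s => g (φ (s - c * h))
  have hf₀ : ∀ s, 0 ≤ f s := fun s => hUM.nonneg _ (hpos _).le
  have hfM : ∀ s, f s ≤ g θ := fun s => hUM.global_max _ (hpos _).le
  have hf_abs : ∀ s, |f s| ≤ g θ := fun s => by rw [abs_of_nonneg (hf₀ s)]; exact hfM s
  have hf : Continuous f :=
    hUM.cont.comp_continuous (hdiff.continuous.comp (continuous_id.sub continuous_const))
      fun s => (hpos _).le
  have hbound : ∀ z s : ℝ, |deriv φ s| ≤ g θ → |deriv φ s - z * φ s| ≤ g θ + |z| * g θ := by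
    intro z s hs
    refine (abs_sub _ _).trans (add_le_add hs ?_)
    rw [abs_mul, abs_of_pos (hpos s)]
    exact mul_le_mul_of_nonneg_left (hbd s) (abs_nonneg z)
  have hfactor : ∀ z s : ℝ, HasDerivAt (fun s => deriv φ s - z * φ s)
      (deriv (deriv φ) s - z * deriv φ s) s := fun z s =>
    (hdiff' s).hasDerivAt.sub ((hdiff s).hasDerivAt.const_mul z)
  have hv : ∀ t, deriv φ t - z₁ * φ t = ∫ s in Ici t, Real.exp (z₂ * (t - s)) * f s := by
    choose σ hσ hσM using fun n : ℕ =>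
      exists_abs_deriv_le_of_mem_Icc hdiff (fun t => (hpos t).le) hbd n
    refine eq_integral_Ici_of_hasDerivAt hz₂ hf hf_abs (fun s => ?_)
      (tendsto_atTop_mono (fun n => (hσ n).1.le) tendsto_natCast_atTop_atTop)
      (fun n => hbound z₁ _ (hσM n))
    refine (hfactor z₁ s).congr_deriv ?_
    linear_combination heq s - deriv φ s * hsum + φ s * hprod
  have hu : ∀ t, -(deriv φ (-t) - z₂ * φ (-t)) =
      ∫ s in Ici t, Real.exp (-z₁ * (t - s)) * f (-s) := by
    choose σ hσ hσM using fun n : ℕ =>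
      exists_abs_deriv_le_of_mem_Icc hdiff (fun t => (hpos t).le) hbd (-(n : ℝ) - 1)
    refine eq_integral_Ici_of_hasDerivAt (v := fun t => -(deriv φ (-t) - z₂ * φ (-t)))
      (σ := fun n => -σ n) (C := g θ + |z₂| * g θ) (neg_pos.mpr hz₁) (hf.comp continuous_neg)
      (fun s => hf_abs (-s)) (fun s => ?_) ?_ (fun n => ?_)
    · refine ((hfactor z₂ (-s)).comp s (hasDerivAt_neg s)).neg.congr_deriv ?_
      linear_combination heq (-s) - deriv φ (-s) * hsum + φ (-s) * hprod
    · exact tendsto_atTop_mono (fun n => by linarith [(hσ n).2]) tendsto_natCast_atTop_atTop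
    · simpa only [neg_neg, abs_neg] using hbound z₂ _ (hσM n)
  refine ⟨fun t => ?_, fun t => ?_⟩
  · have hleft : ∫ s in Iic t, Real.exp (z₁ * (t - s)) * f s = -(deriv φ t - z₂ * φ t) := by
      have h := hu (-t)
      rw [neg_neg, integral_Ici_eq_integral_Ioi, ← integral_comp_neg_Iic] at h
      rw [h]
      refine setIntegral_congr_fun measurableSet_Iic fun s _ => ?_
      simp only [neg_neg]
      ring_nf
    rw [hleft, ← hv t]
    field_simp [(sub_pos.mpr hlt).ne']
    ring
  · have hsqrt : Real.sqrt (c ^ 2 + 4) = z₂ - z₁ := by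
      rw [show c ^ 2 + 4 = (z₂ - z₁) ^ 2 by rw [← hsum]; linear_combination 4 * hprod]
      exact Real.sqrt_sq (sub_pos.mpr hlt).le
    have h₂ := integral_Ici_exp_mul_mem_Icc hz₂ hf₀ hfM t
    have h₁ := integral_Ici_exp_mul_mem_Icc (neg_pos.mpr hz₁) (fun s => hf₀ (-s))
      (fun s => hfM (-s)) (-t)
    rw [← hv t] at h₂
    rw [← hu (-t), neg_neg] at h₁
    rw [hsqrt, le_div_iff₀ (sub_pos.mpr hlt), ← abs_of_pos (sub_pos.mpr hlt), ← abs_mul, abs_le]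
    constructor <;> nlinarith [h₁.1, h₁.2, h₂.1, h₂.2]

end
end
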